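/- Under the SITA assumption that T and Y₁ are conditionally independent given σ(X), with τ a σ(X)-measurable version of E[T | σ(X)] satisfying c₁ ≤ τ ≤ c₂ almost surely (0 < c₁ ≤ c₂ < 1), for every σ(X)-measurable integrable random variable m the random variable m + T·(Y₁ − m)/τ is integrable and E[m + T·(Y₁ − m)/τ] = E[Y₁]. (This is the augmented IPW identity when the propensity score model is correctly specified, for an arbitrary — possibly misspecified — outcome regression m.) -/

import Mathlib

open MeasureTheory ProbabilityTheory

namespace ProbabilityTheory

variable {Ω : Type*} {m mΩ : MeasurableSpace Ω} [StandardBorelSpace Ω] {hm : m ≤ mΩ}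
  {μ : Measure Ω} [IsFiniteMeasure μ]

/-- Conditionally independent random variables are almost surely independent under the
conditional expectation kernel. -/
theorem CondIndepFun.ae_indepFun_condExpKernel {β β' : Type*} [MeasurableSpace β]
    [MeasurableSpace β'] [MeasurableSpace.CountablyGenerated (β × β')] {f : Ω → β} {g : Ω → β'}
    (h : CondIndepFun m hm f g μ) (hf : AEMeasurable f μ) (hg : AEMeasurable g μ) :
    ∀ᵐ ω ∂μ, IndepFun f g (condExpKernel μ m ω) := by
  have hf' : ∀ᵐ ω ∂μ.trim hm, f =ᵐ[condExpKernel μ m ω] hf.mk f := by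
    refine Measure.ae_ae_of_ae_comp ?_
    rw [condExpKernel_comp_trim hm]
    exact hf.ae_eq_mk
  have hg' : ∀ᵐ ω ∂μ.trim hm, g =ᵐ[condExpKernel μ m ω] hg.mk g := by
    refine Measure.ae_ae_of_ae_comp ?_
    rw [condExpKernel_comp_trim hm]
    exact hg.ae_eq_mk
  have h_mk : CondIndepFun m hm (hf.mk f) (hg.mk g) μ := Kernel.IndepFun.congr' h hf' hg'
  have h_map := (condIndepFun_iff_map_prod_eq_prod_map_map hf.measurable_mk
    hg.measurable_mk).1 h_mk
  filter_upwards [ae_of_ae_trim hm h_map, ae_of_ae_trim hm hf', ae_of_ae_trim hm hg']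
    with ω hω hfω hgω
  refine IndepFun.congr ?_ hfω.symm hgω.symm
  rw [indepFun_iff_map_prod_eq_prod_map_map hf.measurable_mk.aemeasurable
    hg.measurable_mk.aemeasurable]
  rwa [Kernel.prod_apply, Kernel.map_apply _ (hf.measurable_mk.prodMk hg.measurable_mk),
    Kernel.map_apply _ hf.measurable_mk, Kernel.map_apply _ hg.measurable_mk] at hω

/-- The conditional expectation of a product of conditionally independent random variables is
the product of their conditional expectations. -/
theorem CondIndepFun.condExp_mul {f g : Ω → ℝ} (h : CondIndepFun m hm f g μ)
    (hf : Integrable f μ) (hg : Integrable g μ) (hfg : Integrable (f * g) μ) :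
    μ[f * g | m] =ᵐ[μ] μ[f | m] * μ[g | m] := by
  filter_upwards [h.ae_indepFun_condExpKernel hf.aemeasurable hg.aemeasurable,
    condExp_ae_eq_integral_condExpKernel hm hf, condExp_ae_eq_integral_condExpKernel hm hg,
    condExp_ae_eq_integral_condExpKernel hm hfg, hf.condExpKernel_ae, hg.condExpKernel_ae]
    with ω hω hfω hgω hfgω hfi hgi
  rw [Pi.mul_apply, hfω, hgω, hfgω]
  exact hω.integral_mul_eq_mul_integral hfi.1 hgi.1

end ProbabilityTheory

/-- Augmented IPW identity with a correctly specified propensity score model: under SITA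
(`T` and `Y₁` conditionally independent given `σ(X)`), with `τ` a `σ(X)`-measurable
version of `E[T | σ(X)]` bounded in `[c₁, c₂] ⊆ (0, 1)`, for every `σ(X)`-measurable
integrable `m` (a possibly misspecified outcome regression) the random variable
`m + T·(Y₁ - m)/τ` is integrable and `E[m + T·(Y₁ - m)/τ] = E[Y₁]`. -/
theorem aipw_identity_correct_ps {Ω : Type*} [mΩ : MeasurableSpace Ω]
    [StandardBorelSpace Ω] [Nonempty Ω]
    {E : Type*} [mE : MeasurableSpace E]
    (μ : Measure Ω) [IsProbabilityMeasure μ]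
    (X : Ω → E) (hX : Measurable X)
    (T : Ω → ℝ) (hTmeas : Measurable T) (hT01 : ∀ ω, T ω = 0 ∨ T ω = 1)
    (Y1 : Ω → ℝ) (hY1 : Integrable Y1 μ)
    (hCI : CondIndepFun (mE.comap X) hX.comap_le T Y1 μ)
    (τ : Ω → ℝ) (hτmeas : Measurable[mE.comap X] τ)
    (hτver : τ =ᵐ[μ] μ[T | mE.comap X])
    (c₁ c₂ : ℝ) (hc₁ : 0 < c₁) (hc₁₂ : c₁ ≤ c₂) (hc₂ : c₂ < 1)
    (hτbd : ∀ᵐ ω ∂μ, c₁ ≤ τ ω ∧ τ ω ≤ c₂)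
    (m : Ω → ℝ) (hmmeas : Measurable[mE.comap X] m) (hmint : Integrable m μ) :
    Integrable (fun ω => m ω + T ω * (Y1 ω - m ω) / τ ω) μ ∧
    ∫ ω, (m ω + T ω * (Y1 ω - m ω) / τ ω) ∂μ = ∫ ω, Y1 ω ∂μ := by
  have hm := hX.comap_le
  have hT_bound : ∀ᵐ ω ∂μ, ‖T ω‖ ≤ 1 := ae_of_all _ fun ω => by
    rcases hT01 ω with h | h <;> simp [h]
  have hT : Integrable T μ := .of_bound hTmeas.aestronglyMeasurable 1 hT_bound
  have hTY : Integrable (T * Y1) μ := hY1.bdd_mul hTmeas.aestronglyMeasurable hT_bound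
  have hTm : Integrable (T * m) μ := hmint.bdd_mul hTmeas.aestronglyMeasurable hT_bound
  have hτinv : StronglyMeasurable[mE.comap X] τ⁻¹ := hτmeas.inv.stronglyMeasurable
  have hτinv_bound : ∀ᵐ ω ∂μ, ‖τ⁻¹ ω‖ ≤ c₁⁻¹ := by
    filter_upwards [hτbd] with ω hω
    rw [Pi.inv_apply, norm_inv, Real.norm_of_nonneg (hc₁.le.trans hω.1)]
    exact inv_anti₀ hc₁ hω.1
  have hint : Integrable (τ⁻¹ * (T * Y1 - T * m)) μ :=
    (hTY.sub hTm).bdd_mul (hτinv.mono hm).aestronglyMeasurable hτinv_bound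
  have hcond : μ[τ⁻¹ * (T * Y1 - T * m) | mE.comap X] =ᵐ[μ] μ[Y1 | mE.comap X] - m := by
    filter_upwards [condExp_stronglyMeasurable_mul_of_bound hm hτinv (hTY.sub hTm) _ hτinv_bound,
      condExp_sub hTY hTm (mE.comap X), hCI.condExp_mul hT hY1 hTY,
      condExp_mul_of_stronglyMeasurable_right hmmeas.stronglyMeasurable hTm hT, hτver, hτbd]
      with ω h_pull h_sub h_TY h_Tm h_τ h_bd
    have hτ0 : τ ω ≠ 0 := (hc₁.trans_le h_bd.1).ne'
    simp only [Pi.mul_apply, Pi.sub_apply, Pi.inv_apply] at *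
    rw [h_pull, h_sub, h_TY, h_Tm, ← h_τ]
    field_simp
  have h_eq : (fun ω => m ω + T ω * (Y1 ω - m ω) / τ ω) = m + τ⁻¹ * (T * Y1 - T * m) := by
    ext ω
    simp only [Pi.add_apply, Pi.mul_apply, Pi.sub_apply, Pi.inv_apply]
    ring
  rw [h_eq]
  refine ⟨hmint.add hint, ?_⟩
  rw [integral_add' hmint hint, ← integral_condExp hm (f := τ⁻¹ * (T * Y1 - T * m)),
    integral_congr_ae hcond, integral_sub' integrable_condExp hmint, integral_condExp hm]
  ring
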